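/- Fix ℓ ∈ {1,…,r} with μ_ℓ ≥ 2. Let Ṽ ⊆ V be the span of the basis vectors v_i^q with (q,i) different from (ℓ, μ_ℓ−1) and from (ℓ, −μ_ℓ+1), let π : V → Ṽ be the linear projection onto Ṽ with kernel spanned by v_{μ_ℓ−1}^ℓ and v_{−μ_ℓ+1}^ℓ, and let ẽ : Ṽ → Ṽ be defined by ẽ(w) = π(e(w)). Let k ≥ 2, let c be an admissible self-dual sequence with c_1 = 1, and let F = (V_0,…,V_{k−1}) be an isotropic partial flag of length k−1 in V with v_{μ_ℓ−1}^ℓ ∈ V_1; let (V̄_0,…,V̄_{2k−1}) be its completion. Set W_p = V_p ∩ Ṽ for p = 0,…,k−1. Then: the restriction of ω to Ṽ is nondegenerate and each W_p is isotropic; and, defining the completion (W̄_0,…,W̄_{2k−1}) inside Ṽ by W̄_p = W_p for p ≤ k−1 and W̄_p = {w ∈ Ṽ : ω(w, u) = 0 for all u ∈ W_{2k−1−p}} for p ≥ k, one has: e(V̄_p) ⊆ V̄_{c_p} for all p = 1,…,2k−1 if and only if ẽ(W̄_p) ⊆ W̄_{c_p} for all p = 1,…,2k−1. -/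

import Mathlib

open Module Submodule

noncomputable section

/-- The orthogonal `W^⊥ = {v : ω(v,w) = 0 for all w ∈ W}` of a subspace with respect to a
bilinear form `ω`. -/
def ortho {V : Type*} [AddCommGroup V] [Module ℂ V]
    (ω : V →ₗ[ℂ] V →ₗ[ℂ] ℂ) (W : Submodule ℂ V) : Submodule ℂ V where
  carrier := {v | ∀ w ∈ W, ω v w = 0}
  zero_mem' := by intro w _; simp
  add_mem' := by
    intro a b ha hb w hw
    rw [map_add, LinearMap.add_apply, ha w hw, hb w hw, add_zero]
  smul_mem' := by
    intro t a ha w hw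
    rw [map_smul, LinearMap.smul_apply, ha w hw, smul_zero]

/-- The completion `(V̄_0, …, V̄_{2k−1})` of an isotropic partial flag `(V_0, …, V_{k−1})`
inside `V`: `V̄_p = V_p` for `p ≤ k−1` and `V̄_p = (V_{2k−1−p})^⊥` for `k ≤ p ≤ 2k−1`. -/
def completion {V : Type*} [AddCommGroup V] [Module ℂ V]
    (ω : V →ₗ[ℂ] V →ₗ[ℂ] ℂ) {k : ℕ} (W : Fin k → Submodule ℂ V) :
    ℕ → Submodule ℂ V := fun p =>
  if h : p < k then W ⟨p, h⟩
  else if h2 : 2 * k - 1 - p < k then ortho ω (W ⟨2 * k - 1 - p, h2⟩) else ⊥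

/-- The completion of an isotropic partial flag computed inside a subspace `U ⊆ V`:
`W̄_p = W_p` for `p ≤ k−1` and `W̄_p = {w ∈ U : ω(w,u) = 0 for all u ∈ W_{2k−1−p}}` for
`k ≤ p ≤ 2k−1`. -/
def completionIn {V : Type*} [AddCommGroup V] [Module ℂ V]
    (ω : V →ₗ[ℂ] V →ₗ[ℂ] ℂ) (U : Submodule ℂ V) {k : ℕ} (W : Fin k → Submodule ℂ V) :
    ℕ → Submodule ℂ V := fun p =>
  if h : p < k then W ⟨p, h⟩
  else if h2 : 2 * k - 1 - p < k then U ⊓ ortho ω (W ⟨2 * k - 1 - p, h2⟩) else ⊥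

/-- `inBlock m i` says that `i` belongs to the index set
`I = {−m+1, −m+3, …, m−3, m−1} ⊆ ℤ` attached to a Jordan block of size `m`. -/
def inBlock (m : ℕ) (i : ℤ) : Prop :=
  1 - (m : ℤ) ≤ i ∧ i ≤ (m : ℤ) - 1 ∧ (2 : ℤ) ∣ (i - ((m : ℤ) - 1))

/-- With the Jordan basis data `v_i^ℓ` for the nilpotent skew-adjoint
`e`, fix `ℓ` with `μ_ℓ ≥ 2`, let `Ṽ` be the span of the basis vectors other than
`v_{±(μ_ℓ−1)}^ℓ`, `π` the projection onto `Ṽ` killing these two vectors, and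
`ẽ = π ∘ e`. For an admissible self-dual sequence `c` with `c₁ = 1` and an isotropic
partial flag `F` with `v_{μ_ℓ−1}^ℓ ∈ V₁`: the restriction of `ω` to `Ṽ` is nondegenerate,
each `W_p = V_p ∩ Ṽ` is isotropic, and `e(V̄_p) ⊆ V̄_{c_p}` for all `1 ≤ p ≤ 2k−1` iff
`ẽ(W̄_p) ⊆ W̄_{c_p}` for all `1 ≤ p ≤ 2k−1` (completions of `W` taken inside `Ṽ`). -/
theorem stmt_19 (V : Type*) [AddCommGroup V] [Module ℂ V] [FiniteDimensional ℂ V]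
    (ω : V →ₗ[ℂ] V →ₗ[ℂ] ℂ)
    (hnd : ∀ x, (∀ w, ω x w = 0) → x = 0)
    (hso : (∀ x w, ω x w = ω w x) ∨ (∀ x, ω x x = 0))
    (e : Module.End ℂ V) (hnil : IsNilpotent e)
    (hskew : ∀ x w, ω (e x) w = - ω x (e w))
    (r : ℕ) (μ : Fin r → ℕ) (hμpos : ∀ q, 1 ≤ μ q)
    (hμanti : ∀ q q' : Fin r, q < q' → μ q' < μ q)
    (v : Fin r → ℤ → V)
    (hbasis : ∃ b : Basis {p : Fin r × ℤ // inBlock (μ p.1) p.2} ℂ V,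
      ∀ p, b p = v p.1.1 p.1.2)
    (he1 : ∀ (q : Fin r) (i : ℤ), inBlock (μ q) i → inBlock (μ q) (i + 2) →
      e (v q i) = v q (i + 2))
    (he2 : ∀ q : Fin r, e (v q ((μ q : ℤ) - 1)) = 0)
    (hω : ∀ (q q' : Fin r) (i j : ℤ), inBlock (μ q) i → inBlock (μ q') j →
      (ω (v q i) (v q' j) ≠ 0 ↔ q = q' ∧ i + j = 0))
    (ℓ : Fin r) (hμℓ : 2 ≤ μ ℓ)
    (Vt : Submodule ℂ V)
    (hVt : Vt = Submodule.span ℂ {x | ∃ (q : Fin r) (i : ℤ), inBlock (μ q) i ∧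
      ¬(q = ℓ ∧ (i = (μ ℓ : ℤ) - 1 ∨ i = 1 - (μ ℓ : ℤ))) ∧ x = v q i})
    (π : V →ₗ[ℂ] V)
    (hπ1 : ∀ w ∈ Vt, π w = w)
    (hπ2 : π (v ℓ ((μ ℓ : ℤ) - 1)) = 0)
    (hπ3 : π (v ℓ (1 - (μ ℓ : ℤ))) = 0)
    (k : ℕ) (hk : 2 ≤ k)
    (c : ℕ → ℕ) (hcmono : ∀ p q, p ≤ q → q < 2 * k → c p ≤ c q)
    (hcle : ∀ p < 2 * k, c p ≤ p)
    (hcsd : ∀ p < 2 * k, c p = ((Finset.Ico 1 (2 * k)).filter fun q => 2 * k - p ≤ c q).card)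
    (hc1 : c 1 = 1)
    (F : Fin k → Submodule ℂ V) (hF0 : F ⟨0, by omega⟩ = ⊥) (hFmono : Monotone F)
    (hFiso : ∀ p, ∀ a ∈ F p, ∀ b ∈ F p, ω a b = 0)
    (hv1 : v ℓ ((μ ℓ : ℤ) - 1) ∈ F ⟨1, by omega⟩) :
    (∀ u ∈ Vt, (∀ w ∈ Vt, ω u w = 0) → u = 0) ∧
    (∀ p : Fin k, ∀ a ∈ F p ⊓ Vt, ∀ b ∈ F p ⊓ Vt, ω a b = 0) ∧
    ((∀ p, 1 ≤ p → p < 2 * k → (completion ω F p).map e ≤ completion ω F (c p)) ↔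
      (∀ p, 1 ≤ p → p < 2 * k →
        (completionIn ω Vt (fun q => F q ⊓ Vt) p).map (π * e)
          ≤ completionIn ω Vt (fun q => F q ⊓ Vt) (c p))) := by
  set x := v ℓ ((μ ℓ : ℤ) - 1) with hx
  set y := v ℓ (1 - (μ ℓ : ℤ)) with hy
  have bx : inBlock (μ ℓ) ((μ ℓ : ℤ) - 1) := by
    refine ⟨by omega, by omega, by simp⟩
  have byy : inBlock (μ ℓ) (1 - (μ ℓ : ℤ)) := by
    refine ⟨by omega, by omega, by omega⟩
  have hz : ∀ (q q' : Fin r) (i j : ℤ), inBlock (μ q) i → inBlock (μ q') j →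
      ¬ (q = q' ∧ i + j = 0) → ω (v q i) (v q' j) = 0 := by
    intro q q' i j hi hj h
    by_contra h'
    exact h ((hω q q' i j hi hj).1 h')
  have hxx : ω x x = 0 := hz _ _ _ _ bx bx (by rintro ⟨-, h⟩; omega)
  have hyx : ω y x ≠ 0 := (hω _ _ _ _ byy bx).2 ⟨rfl, by ring⟩
  have hux : ∀ u ∈ Vt, ω u x = 0 := by
    intro u hu
    rw [hVt] at hu
    induction hu using Submodule.span_induction with
    | mem u hu =>
      obtain ⟨q, i, hi, hn, rfl⟩ := hu
      exact hz _ _ _ _ hi bx (by rintro ⟨rfl, h⟩; exact hn ⟨rfl, Or.inr (by omega)⟩)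
    | zero => simp
    | add a b _ _ ha hb => simp [ha, hb]
    | smul t a _ ha => simp [ha]
  have huy : ∀ u ∈ Vt, ω u y = 0 := by
    intro u hu
    rw [hVt] at hu
    induction hu using Submodule.span_induction with
    | mem u hu =>
      obtain ⟨q, i, hi, hn, rfl⟩ := hu
      exact hz _ _ _ _ hi byy (by rintro ⟨rfl, h⟩; exact hn ⟨rfl, Or.inl (by omega)⟩)
    | zero => simp
    | add a b _ _ ha hb => simp [ha, hb]
    | smul t a _ ha => simp [ha]
  have hdec : ∀ z : V, ∃ a b : ℂ, ∃ u ∈ Vt, z = a • x + b • y + u := by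
    intro z
    obtain ⟨b, hb⟩ := hbasis
    have hz' : z ∈ Submodule.span ℂ (Set.range b) := by rw [b.span_eq]; trivial
    induction hz' using Submodule.span_induction with
    | mem u hu =>
      obtain ⟨⟨⟨q, i⟩, hi⟩, rfl⟩ := hu
      rw [hb]
      by_cases h1 : q = ℓ ∧ i = (μ ℓ : ℤ) - 1
      · obtain ⟨rfl, rfl⟩ := h1
        exact ⟨1, 0, 0, zero_mem _, by simp [hx]⟩
      by_cases h2 : q = ℓ ∧ i = 1 - (μ ℓ : ℤ)
      · obtain ⟨rfl, rfl⟩ := h2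
        exact ⟨0, 1, 0, zero_mem _, by simp [hy]⟩
      refine ⟨0, 0, v q i, ?_, by simp⟩
      rw [hVt]
      exact Submodule.subset_span ⟨q, i, hi, by tauto, rfl⟩
    | zero => exact ⟨0, 0, 0, zero_mem _, by simp⟩
    | add s t _ _ hs ht =>
      obtain ⟨a1, b1, u1, h1, e1⟩ := hs
      obtain ⟨a2, b2, u2, h2, e2⟩ := ht
      exact ⟨a1 + a2, b1 + b2, u1 + u2, add_mem h1 h2, by rw [e1, e2]; module⟩
    | smul t s _ hs =>
      obtain ⟨a1, b1, u1, h1, e1⟩ := hs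
      exact ⟨t * a1, t * b1, t • u1, Vt.smul_mem _ h1, by rw [e1]; module⟩
  -- vectors orthogonal to x
  have hperp : ∀ z : V, ω z x = 0 → ∃ a : ℂ, ∃ u ∈ Vt, z = a • x + u := by
    intro z hzx
    obtain ⟨a, b, u, hu, rfl⟩ := hdec z
    have : b = 0 := by simpa [hxx, hux u hu, hyx] using hzx
    exact ⟨a, u, hu, by simp [this]⟩
  have hπ : ∀ (a : ℂ) (u : V), u ∈ Vt → π (a • x + u) = u := by
    intro a u hu
    rw [map_add, map_smul, hπ2, hπ1 u hu]; simp
  have hπr : ∀ z, π z ∈ Vt := by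
    intro z
    obtain ⟨a, b, u, hu, rfl⟩ := hdec z
    simpa [hπ2, hπ3, hπ1 u hu] using hu
  have hex : ∀ z, ω (e z) x = 0 := by
    intro z; rw [hskew, he2]; simp
  have hxF : ∀ q : Fin k, 1 ≤ q.1 → x ∈ F q := fun q hq =>
    hFmono (show (⟨1, by omega⟩ : Fin k) ≤ q from hq) hv1
  -- structure of the completion
  have hcx : ∀ p, 1 ≤ p → p < 2 * k - 1 → x ∈ completion ω F p := by
    intro p h1 h2
    unfold completion
    split_ifs with h h'
    · exact hxF _ h1
    · intro w hw
      exact hFiso _ _ (hxF ⟨2 * k - 1 - p, h'⟩ (by simp only; omega)) _ hw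
    · omega
  have hcp : ∀ p, 1 ≤ p → p < 2 * k - 1 → ∀ z ∈ completion ω F p, ω z x = 0 := by
    intro p h1 h2 z hzp
    unfold completion at hzp
    split_ifs at hzp with h h'
    · exact hFiso _ _ hzp _ (hxF _ h1)
    · exact hzp _ (hxF _ (by simp only; omega))
    · omega
  have hcin : ∀ p, 1 ≤ p → p < 2 * k - 1 →
      completionIn ω Vt (fun q => F q ⊓ Vt) p = completion ω F p ⊓ Vt := by
    intro p h1 h2
    unfold completion completionIn
    split_ifs with h h'
    · rfl
    · ext z
      constructor
      · rintro ⟨hzV, hzo⟩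
        refine ⟨?_, hzV⟩
        intro w hw
        have hxq := hxF ⟨2 * k - 1 - p, h'⟩ (by simp only; omega)
        obtain ⟨a, u, hu, rfl⟩ := hperp w (hFiso _ _ hw _ hxq)
        have huF : u ∈ F ⟨2 * k - 1 - p, h'⟩ := by
          have := sub_mem hw ((F ⟨2 * k - 1 - p, h'⟩).smul_mem a hxq)
          simpa using this
        have := hzo u ⟨huF, hu⟩
        simp [this, hux z hzV]
      · rintro ⟨hzo, hzV⟩
        exact ⟨hzV, fun w hw => hzo w hw.1⟩
    · omega
  have hctop : c (2 * k - 1) = 2 * k - 1 := by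
    have h := hcsd 1 (by omega)
    rw [hc1] at h
    obtain ⟨q, hq⟩ := Finset.card_pos.1 (by rw [← h]; exact one_pos)
    simp only [Finset.mem_filter, Finset.mem_Ico] at hq
    have := hcle q (by omega)
    have hq' : q = 2 * k - 1 := by omega
    subst hq'
    omega
  have hcr : ∀ p, 1 ≤ p → p < 2 * k - 1 → 1 ≤ c p ∧ c p < 2 * k - 1 := by
    intro p h1 h2
    have := hcmono 1 p h1 (by omega)
    have := hcle p (by omega)
    omega
  refine ⟨?_, ?_, ?_, ?_⟩
  · intro u hu h
    apply hnd
    intro w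
    obtain ⟨a, b, t, ht, rfl⟩ := hdec w
    simp [hux u hu, huy u hu, h t ht]
  · intro p a ha b hb
    exact hFiso p a ha.1 b hb.1
  · intro H p h1 h2
    by_cases hp : p = 2 * k - 1
    · subst hp
      rw [hctop]
      rintro _ ⟨z, -, rfl⟩
      unfold completionIn
      rw [dif_neg (by omega), dif_pos (by omega)]
      refine ⟨hπr _, ?_⟩
      rintro w ⟨hw, -⟩
      have : w = 0 := by
        have h0 : (⟨2 * k - 1 - (2 * k - 1), by omega⟩ : Fin k) = ⟨0, by omega⟩ := by
          ext; simp
        rw [h0, hF0] at hw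
        simpa using hw
      simp [this]
    · have hp' : p < 2 * k - 1 := by omega
      obtain ⟨c1, c2⟩ := hcr p h1 hp'
      rw [hcin p h1 hp', hcin _ c1 c2]
      rintro _ ⟨z, ⟨hzc, hzV⟩, rfl⟩
      have hez := H p h1 h2 ⟨z, hzc, rfl⟩
      refine ⟨?_, hπr _⟩
      obtain ⟨a, u, hu, heq⟩ := hperp (e z) (hex z)
      rw [heq] at hez
      rw [SetLike.mem_coe, Module.End.mul_apply, heq, hπ a u hu]
      have := sub_mem hez ((completion ω F (c p)).smul_mem a (hcx _ c1 c2))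
      simpa using this
  · intro H p h1 h2
    by_cases hp : p = 2 * k - 1
    · subst hp
      rw [hctop]
      rintro _ ⟨z, -, rfl⟩
      unfold completion
      rw [dif_neg (by omega), dif_pos (by omega)]
      intro w hw
      have : w = 0 := by
        have h0 : (⟨2 * k - 1 - (2 * k - 1), by omega⟩ : Fin k) = ⟨0, by omega⟩ := by
          ext; simp
        rw [h0, hF0] at hw
        simpa using hw
      simp [this]
    · have hp' : p < 2 * k - 1 := by omega
      obtain ⟨c1, c2⟩ := hcr p h1 hp'
      have H' := H p h1 h2
      rw [hcin p h1 hp', hcin _ c1 c2] at H'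
      rintro _ ⟨z, hzc, rfl⟩
      obtain ⟨a, u, hu, rfl⟩ := hperp z (hcp p h1 hp' z hzc)
      have huc : u ∈ completion ω F p := by
        have := sub_mem hzc ((completion ω F p).smul_mem a (hcx p h1 hp'))
        simpa using this
      have h3 := (H' ⟨u, ⟨huc, hu⟩, rfl⟩).1
      obtain ⟨b, t, ht, heq⟩ := hperp (e u) (hex u)
      rw [SetLike.mem_coe, Module.End.mul_apply, heq, hπ b t ht] at h3
      have : e (a • x + u) = b • x + t := by rw [map_add, map_smul, he2, heq]; simp
      rw [this]
      exact add_mem (Submodule.smul_mem _ _ (hcx _ c1 c2)) h3
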